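/- arXiv:2006.12467 — 2 statements merged into one kernel-verified Lean document; each statement's English description precedes it below -/
import Mathlib

section
/- (Explicit polynomial form of deep self-attention.) Define C := C(L) = (3^L − 1)/2. For any depth L ≥ 1 and weights Θ, there exist matrices A^{(c,h)}, B^{(c,h)} ∈ ℝ^{d_a×d_x} (for h ∈ [H]^C, 0 ≤ c ≤ C) such that for every i ∈ [N], p ∈ [d_x], and all inputs x^1,…,x^N ∈ ℝ^{d_x}: y_p^{i,L,d_x,H,Θ}(x^1,…,x^N) = Σ_{j₁,…,j_C = 1}^N Σ_{h ∈ [H]^C} Σ_{r₁,…,r_{C+1} = 1}^{d_a} [B^{(0,h)}]_{r₁,p} · (∏_{c=1}^{C} ⟨A^{(c,h)}_{r_c}, x^{j_c}⟩ · ⟨B^{(c,h)}_{r_{c+1}}, x^{j_c}⟩) · ⟨A^{(0,h)}_{r_{C+1}}, x^{i}⟩, where A^{(c,h)}_r denotes the r-th row of A^{(c,h)}. -/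
open scoped BigOperators
open MeasureTheory Matrix

set_option synthInstance.maxSize 4000

/-- Per-head weights `(W^K, W^Q, W^V, W^O)`, stored as plain arrays of reals so that the
weight space carries its natural (Lebesgue) `MeasureSpace` structure. -/
abbrev HeadWeights (da dx : ℕ) : Type :=
  (Fin da → Fin dx → ℝ) × (Fin da → Fin dx → ℝ) ×
  (Fin da → Fin dx → ℝ) × (Fin dx → Fin da → ℝ)

/-- The weight configuration Θ of a depth-`L`, `H`-headed self-attention network,
a point of `ℝ^{4·L·H·d_a·d_x}` (carrying Lebesgue measure `volume`). -/
abbrev SAWeights (L H da dx : ℕ) : Type := Fin L → Fin H → HeadWeights da dx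

/-- A single (multi-headed) self-attention layer:
`y^i = Σ_{j=1}^N Σ_{h=1}^H ⟨W^{Q,h} x^i, W^{K,h} x^j⟩ W^{O,h} W^{V,h} x^j`. -/
noncomputable def saLayer {N H da dx : ℕ} (W : Fin H → HeadWeights da dx)
    (x : Fin N → Fin dx → ℝ) : Fin N → Fin dx → ℝ := fun i =>
  ∑ j : Fin N, ∑ h : Fin H,
    (∑ a : Fin da, (Matrix.of (W h).2.1).mulVec (x i) a * (Matrix.of (W h).1).mulVec (x j) a) •
      (Matrix.of (W h).2.2.2).mulVec ((Matrix.of (W h).2.2.1).mulVec (x j))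

/-- `l`-fold composition of self-attention layers. -/
noncomputable def saNetAux {N H da dx : ℕ} (W : ℕ → Fin H → HeadWeights da dx) :
    ℕ → (Fin N → Fin dx → ℝ) → (Fin N → Fin dx → ℝ)
  | 0, x => x
  | (l + 1), x => saLayer (W l) (saNetAux W l x)

noncomputable def extendW {L H da dx : ℕ} (Θ : SAWeights L H da dx) :
    ℕ → Fin H → HeadWeights da dx := fun l =>
  if h : l < L then Θ ⟨l, h⟩ else fun _ => 0

/-- `y_p^{i,L,d_x,H,Θ}` : the `p`-th coordinate of the depth-`L` self-attention
network output at position `i`, as a scalar function of the `N` inputs. -/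
noncomputable def saOutput {H da dx : ℕ} (L N : ℕ) (Θ : SAWeights L H da dx)
    (i : Fin N) (p : Fin dx) (x : Fin N → Fin dx → ℝ) : ℝ :=
  saNetAux (extendW Θ) L x i p

/-- `f` depends only on the input vectors at positions in `A`. -/
def DependsOnlyOn {N dx : ℕ} (f : (Fin N → Fin dx → ℝ) → ℝ) (A : Finset (Fin N)) : Prop :=
  ∀ x y : Fin N → Fin dx → ℝ, (∀ j ∈ A, x j = y j) → f x = f y

/-- The separation rank of `f : (ℝ^{d_x})^N → ℝ` w.r.t. the partition `(A,B)`: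
the minimal number `R` of summands, each a product of a function of the inputs indexed
by `A` with a function of the inputs indexed by `B`, summing up to `f` (`⊤` if no
finite such decomposition exists). -/
noncomputable def sepRank {N dx : ℕ} (f : (Fin N → Fin dx → ℝ) → ℝ)
    (A B : Finset (Fin N)) : ℕ∞ :=
  sInf {R : ℕ∞ | ∃ n : ℕ, R = (n : ℕ∞) ∧
    ∃ g g' : Fin n → ((Fin N → Fin dx → ℝ) → ℝ),
      (∀ r, DependsOnlyOn (g r) A) ∧ (∀ r, DependsOnlyOn (g' r) B) ∧
      ∀ x, f x = ∑ r : Fin n, g r x * g' r x}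

/-- `C(L) = (3^L − 1)/2`. -/
def CL (L : ℕ) : ℕ := (3 ^ L - 1) / 2

/-- `IsMatrixChain da C F` says that `F S = P₀ * S * P₁ * S * ⋯ * S * P_C` with every `P_c`
factoring through dimension `da`. -/
inductive IsMatrixChain (da : ℕ) {dx : ℕ} :
    ℕ → (Matrix (Fin dx) (Fin dx) ℝ → Matrix (Fin dx) (Fin dx) ℝ) → Prop
  | const (B A : Matrix (Fin da) (Fin dx) ℝ) : IsMatrixChain da 0 (fun _ => Bᵀ * A)
  | step (B A : Matrix (Fin da) (Fin dx) ℝ) {C : ℕ}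
      {F : Matrix (Fin dx) (Fin dx) ℝ → Matrix (Fin dx) (Fin dx) ℝ} (hF : IsMatrixChain da C F) :
      IsMatrixChain da (C + 1) (fun S => Bᵀ * A * S * F S)

namespace IsMatrixChain

variable {da dx C D : ℕ} {F G : Matrix (Fin dx) (Fin dx) ℝ → Matrix (Fin dx) (Fin dx) ℝ}

lemma const_mul (hF : IsMatrixChain da C F) (Q : Matrix (Fin dx) (Fin dx) ℝ) :
    IsMatrixChain da C (fun S => Q * F S) := by
  cases hF with
  | const B A => simpa [Matrix.mul_assoc] using const (B * Qᵀ) A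
  | step B A hF => simpa [Matrix.mul_assoc] using step (B * Qᵀ) A hF

lemma mul (hF : IsMatrixChain da C F) (hG : IsMatrixChain da D G) :
    IsMatrixChain da (C + D) (fun S => F S * G S) := by
  induction hF with
  | const B A => simpa using hG.const_mul (Bᵀ * A)
  | step B A _ ih => simpa [Matrix.mul_assoc, Nat.add_right_comm] using step B A ih

lemma mul_arg_mul (hF : IsMatrixChain da C F) (hG : IsMatrixChain da D G) :
    IsMatrixChain da (C + D + 1) (fun S => F S * S * G S) := by
  induction hF with
  | const B A => simpa using step B A hG
  | step B A _ ih =>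
    simpa [Matrix.mul_assoc, Nat.add_right_comm] using step B A ih

lemma transpose (hF : IsMatrixChain da C F) : IsMatrixChain da C (fun S => (F Sᵀ)ᵀ) := by
  induction hF with
  | const B A => simpa using const A B
  | step B A _ ih => simpa [Matrix.mul_assoc] using ih.mul_arg_mul (const A B)

/-- Entrywise expansion of a chain evaluated at the Gram matrix `∑ j, x j (x j)ᵀ`. -/
lemma exists_expansion (hF : IsMatrixChain da C F) :
    ∃ A B : Fin (C + 1) → Matrix (Fin da) (Fin dx) ℝ,
      ∀ (N : ℕ) (x : Fin N → Fin dx → ℝ) (v : Fin dx → ℝ) (p : Fin dx),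
        (F (∑ j, vecMulVec (x j) (x j)) *ᵥ v) p =
          ∑ j : Fin C → Fin N, ∑ r : Fin (C + 1) → Fin da,
            B 0 (r 0) p *
              (∏ c : Fin C, (A c.castSucc *ᵥ x (j c)) (r c.castSucc) *
                (B c.succ *ᵥ x (j c)) (r c.succ)) *
              (A (Fin.last C) *ᵥ v) (r (Fin.last C)) := by
  induction hF with
  | const B A =>
    refine ⟨fun _ => A, fun _ => B, fun N x v p => ?_⟩
    rw [← Matrix.mulVec_mulVec, Fintype.sum_unique (ι := Fin 0 → Fin N),
      ← (Equiv.funUnique (Fin 1) (Fin da)).symm.sum_comp]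
    simp [Matrix.mulVec, dotProduct]
  | @step B₀ A₀ C F _ ih =>
    obtain ⟨A, B, h⟩ := ih
    refine ⟨Fin.cons A₀ A, Fin.cons B₀ B, fun N x v p => ?_⟩
    have key : ∀ j₀ : Fin N, x j₀ ⬝ᵥ (F (∑ j, vecMulVec (x j) (x j)) *ᵥ v) =
        ∑ j : Fin C → Fin N, ∑ r : Fin (C + 1) → Fin da, (B 0 *ᵥ x j₀) (r 0) *
              ((∏ c : Fin C, (A c.castSucc *ᵥ x (j c)) (r c.castSucc) *
                (B c.succ *ᵥ x (j c)) (r c.succ)) *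
              (A (Fin.last C) *ᵥ v) (r (Fin.last C))) := by
      intro j₀
      simp only [dotProduct, h, Finset.mul_sum]
      rw [Finset.sum_comm]
      refine Finset.sum_congr rfl fun j _ => ?_
      rw [Finset.sum_comm]
      refine Finset.sum_congr rfl fun r _ => ?_
      simp only [Matrix.mulVec, dotProduct, Finset.sum_mul]
      refine Finset.sum_congr rfl fun q _ => ?_
      ring
    have lhs : ((B₀ᵀ * A₀ * (∑ j, vecMulVec (x j) (x j)) *
          F (∑ j, vecMulVec (x j) (x j))) *ᵥ v) p =
        ∑ j₀, ∑ r₀, B₀ r₀ p * (A₀ *ᵥ x j₀) r₀ *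
          (x j₀ ⬝ᵥ (F (∑ j, vecMulVec (x j) (x j)) *ᵥ v)) := by
      rw [← Matrix.mulVec_mulVec]
      generalize F (∑ j, vecMulVec (x j) (x j)) *ᵥ v = w
      rw [← Matrix.mulVec_mulVec, Matrix.sum_mulVec, Matrix.mulVec_sum, Finset.sum_apply]
      refine Finset.sum_congr rfl fun j₀ _ => ?_
      rw [Matrix.vecMulVec_mulVec, ← Matrix.mulVec_mulVec, op_smul_eq_smul,
        Matrix.mulVec_smul, Matrix.mulVec_smul, Pi.smul_apply, smul_eq_mul, mul_comm,
        ← Finset.sum_mul]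
      simp [Matrix.mulVec, dotProduct]
    rw [lhs, ← (Fin.consEquiv fun _ : Fin (C + 1) => Fin N).sum_comp, Fintype.sum_prod_type]
    refine Finset.sum_congr rfl fun j₀ _ => ?_
    simp only [key, Finset.mul_sum]
    rw [Finset.sum_comm]
    refine Finset.sum_congr rfl fun j _ => ?_
    rw [← (Fin.consEquiv fun _ : Fin (C + 2) => Fin da).sum_comp, Fintype.sum_prod_type]
    refine Finset.sum_congr rfl fun r₀ _ => Finset.sum_congr rfl fun r _ => ?_
    simp only [Fin.consEquiv_apply, Fin.prod_univ_succ, Fin.cons_zero, Fin.cons_succ,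
      Fin.castSucc_zero, ← Fin.succ_castSucc, ← Fin.succ_last]
    ring

end IsMatrixChain

/-- The matrix `M` with `saNetAux W l x i = M *ᵥ x i`, as a function of the Gram matrix
`S = ∑ j, x j (x j)ᵀ`. -/
noncomputable def saMatrix {H da dx : ℕ} (W : ℕ → Fin H → HeadWeights da dx) :
    ℕ → Matrix (Fin dx) (Fin dx) ℝ → Matrix (Fin dx) (Fin dx) ℝ
  | 0, _ => 1
  | l + 1, S => ∑ h, (of (W l h).2.2.2 * of (W l h).2.2.1) *
      (saMatrix W l S * S * ((saMatrix W l Sᵀ)ᵀ *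
        (((of (W l h).1)ᵀ * of (W l h).2.1) * saMatrix W l S)))

lemma saNetAux_eq_saMatrix_mulVec {N H da dx : ℕ} (W : ℕ → Fin H → HeadWeights da dx)
    (l : ℕ) (x : Fin N → Fin dx → ℝ) (i : Fin N) :
    saNetAux W l x i = saMatrix W l (∑ j, vecMulVec (x j) (x j)) *ᵥ x i := by
  induction l generalizing i with
  | zero => simp [saNetAux, saMatrix]
  | succ l ih =>
    have hS : (∑ j, vecMulVec (x j) (x j))ᵀ = ∑ j, vecMulVec (x j) (x j) := by
      simp [Matrix.transpose_sum, Matrix.transpose_vecMulVec]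
    simp only [saNetAux, saLayer, saMatrix, ih, hS]
    generalize saMatrix W l (∑ j, vecMulVec (x j) (x j)) = M
    rw [Matrix.sum_mulVec, Finset.sum_comm]
    refine Finset.sum_congr rfl fun h _ => ?_
    simp only [← Matrix.mulVec_mulVec, Matrix.sum_mulVec, Matrix.mulVec_sum]
    refine Finset.sum_congr rfl fun j _ => ?_
    rw [Matrix.vecMulVec_mulVec, op_smul_eq_smul]
    simp only [Matrix.mulVec_smul]
    congr 1
    rw [Matrix.dotProduct_mulVec, Matrix.vecMul_transpose, Matrix.dotProduct_mulVec,
      Matrix.vecMul_transpose, dotProduct_comm]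
    rfl

lemma CL_succ (L : ℕ) : CL (L + 1) = 3 * CL L + 1 := by
  have h : 3 ^ L % 2 = 1 := by simp [Nat.pow_mod]
  simp only [CL, pow_succ]
  omega

lemma saMatrix_eq_sum_isMatrixChain {H da dx : ℕ} (W : ℕ → Fin H → HeadWeights da dx) {L : ℕ}
    (hL : 1 ≤ L) :
    ∃ f : (Fin (CL L) → Fin H) → Matrix (Fin dx) (Fin dx) ℝ → Matrix (Fin dx) (Fin dx) ℝ,
      (∀ h, IsMatrixChain da (CL L) (f h)) ∧ ∀ S, saMatrix W L S = ∑ h, f h S := by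
  induction L, hL using Nat.le_induction with
  | base =>
    rw [show CL 1 = 1 from rfl]
    refine ⟨fun h S => ((of (W 0 (h 0)).2.2.2)ᵀᵀ * of (W 0 (h 0)).2.2.1) * S *
        ((of (W 0 (h 0)).1)ᵀ * of (W 0 (h 0)).2.1),
      fun h => .step (of (W 0 (h 0)).2.2.2)ᵀ _ (.const _ _), fun S => ?_⟩
    rw [← (Equiv.funUnique (Fin 1) (Fin H)).symm.sum_comp]
    simp [saMatrix, Matrix.mul_assoc]
  | succ L _ ih =>
    obtain ⟨f, hf, hsum⟩ := ih
    let ι := Fin (CL L) → Fin H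
    let g : Fin H × ι × ι × ι → Matrix (Fin dx) (Fin dx) ℝ → Matrix (Fin dx) (Fin dx) ℝ :=
      fun k S => (of (W L k.1).2.2.2 * of (W L k.1).2.2.1) *
        (f k.2.1 S * S * ((f k.2.2.1 Sᵀ)ᵀ *
          (((of (W L k.1).1)ᵀ * of (W L k.1).2.1) * f k.2.2.2 S)))
    have hg : ∀ k, IsMatrixChain da (CL (L + 1)) (g k) := fun k => by
      rw [CL_succ, show 3 * CL L + 1 = CL L + (CL L + CL L) + 1 by ring]
      exact ((hf _).mul_arg_mul ((hf _).transpose.mul ((hf _).const_mul _))).const_mul _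
    have hcard : Fintype.card (Fin (CL (L + 1)) → Fin H) =
        Fintype.card (Fin H × ι × ι × ι) := by
      simp only [ι, CL_succ, Fintype.card_prod, Fintype.card_pi, Finset.prod_const,
        Finset.card_univ, Fintype.card_fin]
      ring
    let e := Fintype.equivOfCardEq hcard
    refine ⟨g ∘ e, fun h => hg (e h), fun S => ?_⟩
    simp only [Function.comp_apply]
    rw [e.sum_comp (fun k => g k S)]
    simp only [saMatrix, hsum, g, Fintype.sum_prod_type, ← Matrix.mul_sum, ← Matrix.sum_mul,
      ← Matrix.transpose_sum, ι]

/-- explicit polynomial form of deep self-attention: with `C := (3^L−1)/2`,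
there exist matrices `A^{(c,h)}, B^{(c,h)} ∈ ℝ^{d_a×d_x}` (for multi-indices `h ∈ [H]^C` and
`0 ≤ c ≤ C`, where index `0` stands for the paper's `(0,h)`-matrices and index `c+1` for its
`(c,h)`-matrices, `c = 1,…,C`) such that
`y_p^{i,L,d_x,H,Θ}(x^1,…,x^N) = Σ_{j₁,…,j_C} Σ_{h∈[H]^C} Σ_{r₁,…,r_{C+1}∈[d_a]}
  [B^{(0,h)}]_{r₁,p} (∏_{c=1}^C ⟨A^{(c,h)}_{r_c}, x^{j_c}⟩⟨B^{(c,h)}_{r_{c+1}}, x^{j_c}⟩)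
  ⟨A^{(0,h)}_{r_{C+1}}, x^i⟩`. -/
theorem sa_network_explicit_form
    {L H da dx N : ℕ} (hL : 1 ≤ L) (hdxda : dx = H * da) (hN : 1 < N)
    (Θ : SAWeights L H da dx) :
    ∃ A B : (Fin (CL L) → Fin H) → Fin (CL L + 1) → Matrix (Fin da) (Fin dx) ℝ,
      ∀ (i : Fin N) (p : Fin dx) (x : Fin N → Fin dx → ℝ),
        saOutput L N Θ i p x =
          ∑ j : Fin (CL L) → Fin N, ∑ h : Fin (CL L) → Fin H,
            ∑ r : Fin (CL L + 1) → Fin da,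
              B h 0 (r 0) p *
                (∏ c : Fin (CL L),
                  (∑ q : Fin dx, A h c.succ (r c.castSucc) q * x (j c) q) *
                  (∑ q : Fin dx, B h c.succ (r c.succ) q * x (j c) q)) *
                (∑ q : Fin dx, A h 0 (r (Fin.last (CL L))) q * x i q) := by
  obtain ⟨f, hf, hsum⟩ := saMatrix_eq_sum_isMatrixChain (extendW Θ) hL
  choose A B hAB using fun h => (hf h).exists_expansion
  refine ⟨fun h => Fin.cons (A h (Fin.last _)) fun c => A h c.castSucc, B, fun i p x => ?_⟩
  rw [saOutput, saNetAux_eq_saMatrix_mulVec, hsum, Matrix.sum_mulVec, Finset.sum_apply,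
    Finset.sum_comm]
  refine Finset.sum_congr rfl fun h _ => ?_
  rw [hAB]
  simp only [Fin.cons_zero, Fin.cons_succ, Matrix.mulVec, dotProduct]
end

section
/- (Separation rank upper bound with residual connections, first form.) Consider the depth-L residual self-attention network in which layer l computes f_l (a self-attention layer) and the layer output is its input plus f_l's output, i.e. x^{l+1,j} := x^{l,j} + y^{l,j}. Then for any weights, any balanced partition of [N] (N > 1 even), and any output location i ∈ [N], p ∈ [d_x], the p-th coordinate y_p^{L,i} of the final output satisfies log₃(sep(y_p^{L,i})) ≤ L·log₃ L + (4·log₃ d_x + log₃ N − log₃ H)·(3^L − 1)/2. -/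
open scoped BigOperators
open MeasureTheory Matrix

set_option synthInstance.maxSize 4000

/-- `l`-fold composition of self-attention layers with residual (skip) connections:
each layer's output is its input plus the self-attention computation. -/
noncomputable def saResAux {N H da dx : ℕ} (W : ℕ → Fin H → HeadWeights da dx) :
    ℕ → (Fin N → Fin dx → ℝ) → (Fin N → Fin dx → ℝ)
  | 0, x => x
  | (l + 1), x => saResAux W l x + saLayer (W l) (saResAux W l x)

/-- The `p`-th coordinate of the depth-`L` *residual* self-attention network output at
position `i`. -/
noncomputable def saResOutput {H da dx : ℕ} (L N : ℕ) (Θ : SAWeights L H da dx)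
    (i : Fin N) (p : Fin dx) (x : Fin N → Fin dx → ℝ) : ℝ :=
  saResAux (extendW Θ) L x i p

/-- The algebra of functions that depend only on the input vectors at positions in `A`. -/
def dependsAlgebra {N dx : ℕ} (A : Finset (Fin N)) :
    Subalgebra ℝ ((Fin N → Fin dx → ℝ) → ℝ) where
  carrier := {f | DependsOnlyOn f A}
  mul_mem' hf hg x y h := by simp [hf x y h, hg x y h]
  add_mem' hf hg x y h := by simp [hf x y h, hg x y h]
  algebraMap_mem' r x y _ := rfl

/-- The data carried through the layers: a finite set `S` of functions of the inputs in `B` such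
that all coordinates at positions in `A` are combinations of `S` with coefficients that are
functions of the inputs in `A`. -/
def CoordsSpannedBy {N dx : ℕ} (F : Fin N → Fin dx → (Fin N → Fin dx → ℝ) → ℝ)
    (A B : Finset (Fin N)) (S : Finset ((Fin N → Fin dx → ℝ) → ℝ)) : Prop :=
  1 ∈ S ∧ (∀ s ∈ S, s ∈ dependsAlgebra B) ∧
    ∀ j ∈ A, ∀ c, F j c ∈ Submodule.span (dependsAlgebra (dx := dx) A)
      (S : Set ((Fin N → Fin dx → ℝ) → ℝ))

section

variable {N dx : ℕ} {A B : Finset (Fin N)}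

theorem exists_coeff_of_mem_span_dependsAlgebra {S : Finset ((Fin N → Fin dx → ℝ) → ℝ)}
    {f : (Fin N → Fin dx → ℝ) → ℝ}
    (hf : f ∈ Submodule.span (dependsAlgebra (dx := dx) A)
      (S : Set ((Fin N → Fin dx → ℝ) → ℝ))) :
    ∃ g : ((Fin N → Fin dx → ℝ) → ℝ) → dependsAlgebra (dx := dx) A,
      f = ∑ s ∈ S, (g s : (Fin N → Fin dx → ℝ) → ℝ) * s := by
  obtain ⟨g, -, hg⟩ := Submodule.mem_span_finset.mp hf
  exact ⟨g, hg.symm⟩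

theorem smul_mem_span_dependsAlgebra {S : Set ((Fin N → Fin dx → ℝ) → ℝ)}
    {f : (Fin N → Fin dx → ℝ) → ℝ} (t : ℝ)
    (hf : f ∈ Submodule.span (dependsAlgebra (dx := dx) A) S) :
    t • f ∈ Submodule.span (dependsAlgebra (dx := dx) A) S := by
  rw [← algebraMap_smul (dependsAlgebra (dx := dx) A) t f]
  exact Submodule.smul_mem _ _ hf

/-- Exchanging the roles of the two sides: a finite family spanned by functions of the `A`-inputs
over functions of the `B`-inputs is spanned by the coefficients over functions of the
`A`-inputs. -/
theorem exists_finset_span_swap {ι : Type*} [Fintype ι] {S : Finset ((Fin N → Fin dx → ℝ) → ℝ)}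
    (hS : ∀ s ∈ S, s ∈ dependsAlgebra A) (f : ι → (Fin N → Fin dx → ℝ) → ℝ)
    (hf : ∀ k, f k ∈ Submodule.span (dependsAlgebra (dx := dx) B)
      (S : Set ((Fin N → Fin dx → ℝ) → ℝ))) :
    ∃ T : Finset ((Fin N → Fin dx → ℝ) → ℝ), T.card ≤ Fintype.card ι * S.card ∧
      (∀ t ∈ T, t ∈ dependsAlgebra B) ∧
      ∀ k, f k ∈ Submodule.span (dependsAlgebra (dx := dx) A)
        (T : Set ((Fin N → Fin dx → ℝ) → ℝ)) := by
  classical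
  choose g hg using fun k => exists_coeff_of_mem_span_dependsAlgebra (hf k)
  refine ⟨((Finset.univ : Finset ι) ×ˢ S).image fun q => (g q.1 q.2 : (Fin N → Fin dx → ℝ) → ℝ),
    ?_, ?_, fun k => ?_⟩
  · exact Finset.card_image_le.trans_eq (by simp)
  · intro t ht
    obtain ⟨q, -, rfl⟩ := Finset.mem_image.mp ht
    exact (g q.1 q.2).2
  · rw [hg k]
    refine Submodule.sum_mem _ fun s hs => ?_
    rw [mul_comm]
    refine Submodule.smul_mem _ (⟨s, hS s hs⟩ : dependsAlgebra (dx := dx) A)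
      (Submodule.subset_span ?_)
    exact Finset.mem_coe.mpr (Finset.mem_image.mpr ⟨(k, s), by simp [hs], rfl⟩)

open scoped Pointwise in
theorem mul_mem_span_dependsAlgebra [DecidableEq ((Fin N → Fin dx → ℝ) → ℝ)]
    {S T : Finset ((Fin N → Fin dx → ℝ) → ℝ)} {f g : (Fin N → Fin dx → ℝ) → ℝ}
    (hf : f ∈ Submodule.span (dependsAlgebra (dx := dx) A)
      (S : Set ((Fin N → Fin dx → ℝ) → ℝ)))
    (hg : g ∈ Submodule.span (dependsAlgebra (dx := dx) A)
      (T : Set ((Fin N → Fin dx → ℝ) → ℝ))) :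
    f * g ∈ Submodule.span (dependsAlgebra (dx := dx) A)
      ((S * T : Finset ((Fin N → Fin dx → ℝ) → ℝ)) : Set ((Fin N → Fin dx → ℝ) → ℝ)) := by
  rw [Finset.coe_mul, ← Submodule.span_mul_span]
  exact Submodule.mul_mem_mul hf hg

open scoped Pointwise in
/-- A layer that is cubic in its input, and linear in the Gram sums over all positions, enlarges
the spanning sets at most to `(1 + dx ^ 2) * m ^ 3` elements. -/
theorem CoordsSpannedBy.exists_layer {F G : Fin N → Fin dx → (Fin N → Fin dx → ℝ) → ℝ}
    {S T : Finset ((Fin N → Fin dx → ℝ) → ℝ)} {m : ℕ}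
    (hAB : Disjoint A B) (hABcov : A ∪ B = Finset.univ)
    (hS : CoordsSpannedBy F A B S) (hT : CoordsSpannedBy F B A T)
    (hSm : S.card ≤ m) (hTm : T.card ≤ m)
    (C : Fin dx → Fin dx → Fin dx → Fin dx → ℝ)
    (hG : ∀ i p, G i p = F i p +
      ∑ b, ∑ c, ∑ d, C p b c d • (F i b * ∑ j, F j c * F j d)) :
    ∃ S', CoordsSpannedBy G A B S' ∧ S'.card ≤ (1 + dx ^ 2) * m ^ 3 := by
  classical
  obtain ⟨hS1, hSB, hSF⟩ := hS
  obtain ⟨hT1, hTA, hTF⟩ := hT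
  obtain ⟨U, hUcard, hUB, hU⟩ := exists_finset_span_swap (A := A) (B := B)
    (S := T * T) (ι := Fin dx × Fin dx)
    (fun s hs => by
      obtain ⟨t, ht, t', ht', rfl⟩ := Finset.mem_mul.mp hs
      exact mul_mem (hTA t ht) (hTA t' ht'))
    (fun q => ∑ j ∈ B, F j q.1 * F j q.2)
    (fun q => Submodule.sum_mem _ fun j hj =>
      mul_mem_span_dependsAlgebra (hTF j hj q.1) (hTF j hj q.2))
  have hgram : ∀ c d, ∑ j, F j c * F j d ∈ Submodule.span (dependsAlgebra (dx := dx) A)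
      ((S * S ∪ U : Finset ((Fin N → Fin dx → ℝ) → ℝ)) :
        Set ((Fin N → Fin dx → ℝ) → ℝ)) := by
    intro c d
    rw [← hABcov, Finset.sum_union hAB, Finset.coe_union]
    refine Submodule.add_mem _ (Submodule.sum_mem _ fun j hj => ?_) ?_
    · exact Submodule.span_mono Set.subset_union_left
        (mul_mem_span_dependsAlgebra (hSF j hj c) (hSF j hj d))
    · exact Submodule.span_mono Set.subset_union_right (hU (c, d))
  have hone : (1 : (Fin N → Fin dx → ℝ) → ℝ) ∈ S * S ∪ U :=
    Finset.mem_union_left _ (Finset.mem_mul.mpr ⟨1, hS1, 1, hS1, one_mul 1⟩)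
  refine ⟨S * (S * S ∪ U), ⟨?_, ?_, ?_⟩, ?_⟩
  · exact Finset.mem_mul.mpr ⟨1, hS1, 1, hone, one_mul 1⟩
  · intro s hs
    obtain ⟨t, ht, u, hu, rfl⟩ := Finset.mem_mul.mp hs
    refine mul_mem (hSB t ht) ?_
    rcases Finset.mem_union.mp hu with hu | hu
    · obtain ⟨v, hv, w, hw, rfl⟩ := Finset.mem_mul.mp hu
      exact mul_mem (hSB v hv) (hSB w hw)
    · exact hUB u hu
  · intro i hi p
    rw [hG]
    refine Submodule.add_mem _ ?_ ?_
    · rw [← mul_one (F i p)]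
      exact mul_mem_span_dependsAlgebra (hSF i hi p) (Submodule.subset_span hone)
    · exact Submodule.sum_mem _ fun b _ => Submodule.sum_mem _ fun c _ =>
        Submodule.sum_mem _ fun d _ => smul_mem_span_dependsAlgebra _
          (mul_mem_span_dependsAlgebra (hSF i hi b) (hgram c d))
  · have hSS : (S * S).card ≤ m * m := Finset.card_mul_le.trans (Nat.mul_le_mul hSm hSm)
    have hTT : (T * T).card ≤ m * m := Finset.card_mul_le.trans (Nat.mul_le_mul hTm hTm)
    have hU' : U.card ≤ dx * dx * (m * m) := by
      refine hUcard.trans ?_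
      rw [Fintype.card_prod, Fintype.card_fin]
      exact Nat.mul_le_mul_left _ hTT
    calc (S * (S * S ∪ U)).card ≤ S.card * (S * S ∪ U).card := Finset.card_mul_le
      _ ≤ m * (m * m + dx * dx * (m * m)) :=
        Nat.mul_le_mul hSm ((Finset.card_union_le _ _).trans (Nat.add_le_add hSS hU'))
      _ = (1 + dx ^ 2) * m ^ 3 := by ring

theorem coordsSpannedBy_coord :
    CoordsSpannedBy (fun (j : Fin N) (c : Fin dx) x => x j c) A B {1} := by
  refine ⟨by simp, ?_, fun j hj c => ?_⟩
  · intro s hs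
    rw [Finset.mem_singleton.mp hs]
    exact one_mem _
  · have hmem : (fun x : Fin N → Fin dx → ℝ => x j c) ∈ dependsAlgebra A :=
      fun x y h => by simp only [h j hj]
    have := Submodule.smul_mem (Submodule.span (dependsAlgebra (dx := dx) A)
      (({1} : Finset ((Fin N → Fin dx → ℝ) → ℝ)) : Set ((Fin N → Fin dx → ℝ) → ℝ)))
      ⟨_, hmem⟩ (Submodule.subset_span (by simp : (1 : (Fin N → Fin dx → ℝ) → ℝ) ∈ _))
    rwa [Subalgebra.smul_def, smul_eq_mul, mul_one] at this

theorem sum_rotate {α β γ δ : Type*} [Fintype α] [Fintype β] [Fintype γ] [Fintype δ]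
    (f : α → β → γ → δ → ℝ) :
    ∑ a, ∑ b, ∑ c, ∑ d, f a b c d = ∑ b, ∑ c, ∑ d, ∑ a, f a b c d := by
  rw [Finset.sum_comm]
  refine Finset.sum_congr rfl fun b _ => ?_
  rw [Finset.sum_comm]
  exact Finset.sum_congr rfl fun c _ => Finset.sum_comm

/-- A self-attention layer is linear in its query input and in the Gram sums over positions. -/
theorem saLayer_eq_sum_gram {H da : ℕ} (W : Fin H → HeadWeights da dx)
    (x : Fin N → Fin dx → ℝ) (i : Fin N) (p : Fin dx) :
    saLayer W x i p = ∑ b, ∑ c, ∑ d,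
      (∑ h, ∑ a, ∑ e, (W h).2.1 a b * (W h).1 a c * (W h).2.2.2 p e * (W h).2.2.1 e d) *
        (x i b * ∑ j, x j c * x j d) := by
  have hterm : ∀ j h, (∑ a : Fin da, (Matrix.of (W h).2.1).mulVec (x i) a *
      (Matrix.of (W h).1).mulVec (x j) a) *
      (Matrix.of (W h).2.2.2).mulVec ((Matrix.of (W h).2.2.1).mulVec (x j)) p =
      ∑ b, ∑ c, ∑ d, ∑ a, ∑ e, (W h).2.1 a b * (W h).1 a c * (W h).2.2.2 p e *
        (W h).2.2.1 e d * (x i b * (x j c * x j d)) := by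
    intro j h
    rw [← sum_rotate, Finset.sum_mul]
    refine Finset.sum_congr rfl fun a _ => ?_
    simp only [mulVec, dotProduct, Matrix.of_apply]
    rw [Finset.mul_sum, ← sum_rotate]
    refine Finset.sum_congr rfl fun e _ => ?_
    rw [Finset.sum_mul_sum, Finset.sum_mul]
    refine Finset.sum_congr rfl fun b _ => ?_
    rw [Finset.sum_mul]
    refine Finset.sum_congr rfl fun c _ => ?_
    rw [Finset.mul_sum, Finset.mul_sum]
    exact Finset.sum_congr rfl fun d _ => by ring
  simp only [saLayer, Finset.sum_apply, Pi.smul_apply, smul_eq_mul, hterm]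
  refine (Finset.sum_congr rfl fun j _ => sum_rotate _).trans ((sum_rotate _).trans ?_)
  refine Finset.sum_congr rfl fun b _ => Finset.sum_congr rfl fun c _ =>
    Finset.sum_congr rfl fun d _ => ?_
  rw [Finset.mul_sum, Finset.mul_sum]
  exact Finset.sum_congr rfl fun j _ => by simp only [Finset.sum_mul]

theorem exists_coordsSpannedBy_saResAux {H da : ℕ} (W : ℕ → Fin H → HeadWeights da dx)
    (hAB : Disjoint A B) (hABcov : A ∪ B = Finset.univ) (l : ℕ) :
    ∃ e, 2 * e + 1 = 3 ^ l ∧ ∃ S T : Finset ((Fin N → Fin dx → ℝ) → ℝ),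
      CoordsSpannedBy (fun j c x => saResAux W l x j c) A B S ∧
      CoordsSpannedBy (fun j c x => saResAux W l x j c) B A T ∧
      S.card ≤ (1 + dx ^ 2) ^ e ∧ T.card ≤ (1 + dx ^ 2) ^ e := by
  induction l with
  | zero => exact ⟨0, rfl, {1}, {1}, coordsSpannedBy_coord, coordsSpannedBy_coord, by simp, by simp⟩
  | succ l ih =>
    obtain ⟨e, he, S, T, hS, hT, hSm, hTm⟩ := ih
    have hG : ∀ i p, (fun x : Fin N → Fin dx → ℝ => saResAux W (l + 1) x i p) =
        (fun x => saResAux W l x i p) + ∑ b, ∑ c, ∑ d,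
          (∑ h, ∑ a, ∑ e, (W l h).2.1 a b * (W l h).1 a c * (W l h).2.2.2 p e *
            (W l h).2.2.1 e d) • ((fun x => saResAux W l x i b) *
            ∑ j, (fun x => saResAux W l x j c) * (fun x => saResAux W l x j d)) := by
      intro i p
      funext x
      simp only [saResAux, Pi.add_apply, saLayer_eq_sum_gram, Finset.sum_apply, Pi.smul_apply,
        Pi.mul_apply, smul_eq_mul]
    obtain ⟨S', hS', hSc⟩ := hS.exists_layer hAB hABcov hT hSm hTm
      (G := fun i p x => saResAux W (l + 1) x i p) _ hG
    obtain ⟨T', hT', hTc⟩ := hT.exists_layer hAB.symm (by rwa [Finset.union_comm]) hS hTm hSm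
      (G := fun i p x => saResAux W (l + 1) x i p) _ hG
    have hpow : (1 + dx ^ 2) * ((1 + dx ^ 2) ^ e) ^ 3 = (1 + dx ^ 2) ^ (3 * e + 1) := by ring
    rw [hpow] at hSc hTc
    exact ⟨3 * e + 1, by rw [pow_succ]; omega, S', T', hS', hT', hSc, hTc⟩

theorem sepRank_le_card_of_mem_span {S : Finset ((Fin N → Fin dx → ℝ) → ℝ)}
    {f : (Fin N → Fin dx → ℝ) → ℝ} (hS : ∀ s ∈ S, s ∈ dependsAlgebra B)
    (hf : f ∈ Submodule.span (dependsAlgebra (dx := dx) A)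
      (S : Set ((Fin N → Fin dx → ℝ) → ℝ))) :
    sepRank f A B ≤ S.card := by
  obtain ⟨g, hg⟩ := exists_coeff_of_mem_span_dependsAlgebra hf
  refine sInf_le ⟨S.card, rfl, fun r => g (S.equivFin.symm r), fun r => S.equivFin.symm r,
    fun r => (g _).2, fun r => hS _ (S.equivFin.symm r).2, fun x => ?_⟩
  rw [S.equivFin.symm.sum_comp
    (fun s : S => (g s : (Fin N → Fin dx → ℝ) → ℝ) x * (s : (Fin N → Fin dx → ℝ) → ℝ) x),
    Finset.sum_coe_sort S fun s => (g s : (Fin N → Fin dx → ℝ) → ℝ) x * s x]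
  conv_lhs => rw [hg]
  simp

theorem sepRank_comm (f : (Fin N → Fin dx → ℝ) → ℝ) : sepRank f A B = sepRank f B A := by
  have key : ∀ {A B : Finset (Fin N)}, sepRank f A B ≤ sepRank f B A := by
    refine fun {A B} => sInf_le_sInf ?_
    rintro R ⟨n, hn, g, g', hg, hg', hf⟩
    exact ⟨n, hn, g', g, hg', hg, fun x => by simp_rw [hf x, mul_comm]⟩
  exact le_antisymm key key

end

/-- separation rank upper bound with residual connections, first form:
for the depth-`L` residual self-attention network, any weights, any balanced partition and
any output location, `log₃ sep(y_p^{L,i}) ≤ L·log₃L + (4log₃d_x + log₃N − log₃H)·(3^L−1)/2`. -/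
theorem sepRank_residual_upper_bound_depth
    {L H da dx N : ℕ} (hN : 1 < N) (hNeven : Even N) (hdxda : dx = H * da)
    (Θ : SAWeights L H da dx) (i : Fin N) (p : Fin dx)
    (A B : Finset (Fin N)) (hAB : Disjoint A B) (hABcov : A ∪ B = Finset.univ)
    (hA : A.card = N / 2) (hB : B.card = N / 2) :
    ∃ n : ℕ, sepRank (saResOutput L N Θ i p) A B = (n : ℕ∞) ∧
      Real.logb 3 (n : ℝ) ≤
        (L : ℝ) * Real.logb 3 (L : ℝ) +
          (4 * Real.logb 3 (dx : ℝ) + Real.logb 3 (N : ℝ) - Real.logb 3 (H : ℝ)) *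
            (((3 : ℝ) ^ L - 1) / 2) := by
  have hdx : 1 ≤ dx := (Nat.zero_le _).trans_lt p.2
  have hH : 1 ≤ H := Nat.pos_of_ne_zero fun h => by simp [h] at hdxda; omega
  have hda : 1 ≤ da := Nat.pos_of_ne_zero fun h => by simp [h] at hdxda; omega
  obtain ⟨e, he, S, T, hS, hT, hSc, hTc⟩ :=
    exists_coordsSpannedBy_saResAux (extendW Θ) hAB hABcov L
  have hrank : sepRank (saResOutput L N Θ i p) A B ≤ (((1 + dx ^ 2) ^ e : ℕ) : ℕ∞) := by
    rcases Finset.mem_union.mp (hABcov ▸ Finset.mem_univ i) with hi | hi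
    · exact (sepRank_le_card_of_mem_span hS.2.1 (hS.2.2 i hi p)).trans (by exact_mod_cast hSc)
    · rw [sepRank_comm]
      exact (sepRank_le_card_of_mem_span hT.2.1 (hT.2.2 i hi p)).trans (by exact_mod_cast hTc)
  obtain ⟨n, hn⟩ := ENat.ne_top_iff_exists.mp (ne_top_of_le_ne_top (ENat.natCast_ne_top _) hrank)
  refine ⟨n, hn.symm, ?_⟩
  rw [← hn] at hrank
  have hn' : n ≤ (1 + dx ^ 2) ^ e := by exact_mod_cast hrank
  have hexp : ((3 : ℝ) ^ L - 1) / 2 = e := by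
    have : (2 * e + 1 : ℝ) = 3 ^ L := by exact_mod_cast he
    linarith
  have hbase : (1 + dx ^ 2) * H ≤ dx ^ 4 * N := by
    have hHdx : H ≤ dx := hdxda ▸ Nat.le_mul_of_pos_right H hda
    have h1 : 1 + dx ^ 2 ≤ dx ^ 2 * N := by nlinarith [Nat.one_le_pow 2 dx hdx]
    have h2 : H ≤ dx ^ 2 := hHdx.trans (Nat.le_self_pow two_ne_zero dx)
    calc (1 + dx ^ 2) * H ≤ dx ^ 2 * N * dx ^ 2 := Nat.mul_le_mul h1 h2
      _ = dx ^ 4 * N := by ring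
  have hdx0 : (dx : ℝ) ≠ 0 := by positivity
  have hH0 : (H : ℝ) ≠ 0 := by positivity
  have hN0 : (N : ℝ) ≠ 0 := by positivity
  have hlogbase : Real.logb 3 (1 + (dx : ℝ) ^ 2) ≤
      4 * Real.logb 3 (dx : ℝ) + Real.logb 3 (N : ℝ) - Real.logb 3 (H : ℝ) := by
    have h := Real.logb_le_logb_of_le (b := 3) (by norm_num) (by positivity)
      (by exact_mod_cast hbase : (1 + (dx : ℝ) ^ 2) * H ≤ dx ^ 4 * N)
    rw [Real.logb_mul (by positivity) hH0, Real.logb_mul (by positivity) hN0,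
      Real.logb_pow] at h
    push_cast at h
    linarith
  have hlog : Real.logb 3 (n : ℝ) ≤ e * Real.logb 3 (1 + (dx : ℝ) ^ 2) := by
    rw [← Real.logb_pow]
    rcases Nat.eq_zero_or_pos n with rfl | hpos
    · rw [Nat.cast_zero, Real.logb_zero]
      exact Real.logb_nonneg (by norm_num) (one_le_pow₀ (by nlinarith [sq_nonneg (dx : ℝ)]))
    · exact Real.logb_le_logb_of_le (by norm_num) (by exact_mod_cast hpos) (by exact_mod_cast hn')
  have hL : 0 ≤ (L : ℝ) * Real.logb 3 (L : ℝ) := by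
    rcases Nat.eq_zero_or_pos L with rfl | hpos
    · simp
    · exact mul_nonneg (Nat.cast_nonneg _)
        (Real.logb_nonneg (by norm_num) (by exact_mod_cast hpos))
  rw [hexp]
  have := mul_le_mul_of_nonneg_right hlogbase (Nat.cast_nonneg (α := ℝ) e)
  linarith
end
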